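/- Support theorem for the classical Radon transform: let f ∈ S(R^n) and R₀ > 0. If Rf(ω,p) = 0 whenever |p| > R₀, then f(x) = 0 for all ‖x‖ > R₀. -/

import Mathlib

open MeasureTheory

noncomputable section

/-- The classical Radon transform over hyperplanes. -/
def radonTransform {n : ℕ} (f : EuclideanSpace ℝ (Fin n) → ℂ)
    (ω : EuclideanSpace ℝ (Fin n)) (p : ℝ) : ℂ :=
  ∫ v : (ℝ ∙ ω)ᗮ, f (p • ω + (v : EuclideanSpace ℝ (Fin n)))

section RadonSupport

open Filter Topology

variable {E : Type*} [NormedAddCommGroup E] [InnerProductSpace ℝ E]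

theorem abs_inner_le_growth {φ : ℝ → ℝ} {C : ℝ} {k : ℕ} (hφ : ∀ p, |φ p| ≤ C * (1 + |p|) ^ k)
    {ξ : E} {M : ℝ} (hM : ‖ξ‖ ≤ M) (x : E) :
    |φ (inner ℝ ξ x)| ≤ C * (1 + M) ^ k * (1 + ‖x‖) ^ k := by
  have hC : 0 ≤ C := by simpa using (abs_nonneg _).trans (hφ 0)
  have hM0 : 0 ≤ M := (norm_nonneg _).trans hM
  refine (hφ _).trans ?_
  rw [mul_assoc, ← mul_pow]
  have h₁ : |inner ℝ ξ x| ≤ M * ‖x‖ := (abs_real_inner_le_norm ξ x).trans (by gcongr)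
  gcongr
  nlinarith [norm_nonneg x]

/-- A kernel on the dual space which, for fixed `ξ`, is a ridge function vanishing for
`|p| ≤ r * ‖ξ‖`. -/
def coneKernel (r : ℝ) (ξ : E) (p : ℝ) : ℝ :=
  √(p ^ 2 - r ^ 2 * ‖ξ‖ ^ 2) ^ (Module.finrank ℝ E + 1) * max 0 (1 - |p|)

theorem coneKernel_nonneg (r : ℝ) (ξ : E) (p : ℝ) : 0 ≤ coneKernel r ξ p := by
  unfold coneKernel
  positivity

theorem coneKernel_eq_zero {r : ℝ} {ξ : E} {p : ℝ} (h : |p| ≤ r * ‖ξ‖) :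
    coneKernel r ξ p = 0 := by
  have : p ^ 2 ≤ r ^ 2 * ‖ξ‖ ^ 2 := by
    rw [← mul_pow]
    exact sq_le_sq' (abs_le.1 h).1 (abs_le.1 h).2
  rw [coneKernel, Real.sqrt_eq_zero_of_nonpos (by linarith)]
  simp

theorem coneKernel_eq_zero_of_one_le {r : ℝ} {ξ : E} {p : ℝ} (h : 1 ≤ |p|) :
    coneKernel r ξ p = 0 := by
  rw [coneKernel, max_eq_left (by linarith), mul_zero]

theorem coneKernel_le_one (r : ℝ) (ξ : E) (p : ℝ) : coneKernel r ξ p ≤ 1 := by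
  rcases le_or_gt 1 |p| with h | h
  · rw [coneKernel_eq_zero_of_one_le h]
    exact zero_le_one
  · have h₁ : √(p ^ 2 - r ^ 2 * ‖ξ‖ ^ 2) ≤ 1 := by
      rw [Real.sqrt_le_one]
      have := (sq_lt_one_iff_abs_lt_one p).2 h
      nlinarith [sq_nonneg (r * ‖ξ‖)]
    exact mul_le_one₀ (pow_le_one₀ (Real.sqrt_nonneg _) h₁) (le_max_left _ _)
      (max_le zero_le_one (by linarith [abs_nonneg p]))

theorem coneKernel_eq_zero_of_le_norm {r : ℝ} (hr : 0 < r) {ξ : E} (h : r⁻¹ ≤ ‖ξ‖) (p : ℝ) :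
    coneKernel r ξ p = 0 := by
  rcases le_or_gt 1 |p| with hp | hp
  · exact coneKernel_eq_zero_of_one_le hp
  · refine coneKernel_eq_zero (hp.le.trans ?_)
    rwa [inv_le_iff_one_le_mul₀' hr] at h

theorem continuous_coneKernel (r : ℝ) : Continuous fun q : E × ℝ ↦ coneKernel r q.1 q.2 := by
  unfold coneKernel
  fun_prop

theorem continuous_coneKernel_inner (r : ℝ) (x : E) :
    Continuous fun ξ : E ↦ coneKernel r ξ (inner ℝ ξ x) :=
  (continuous_coneKernel r).comp (continuous_id.prodMk (by fun_prop))

variable [FiniteDimensional ℝ E]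

theorem hasCompactSupport_coneKernel {r : ℝ} (hr : 0 < r) (x : E) :
    HasCompactSupport fun ξ : E ↦ coneKernel r ξ (inner ℝ ξ x) :=
  HasCompactSupport.of_support_subset_isCompact (isCompact_closedBall 0 r⁻¹) fun ξ hξ ↦ by
    rw [mem_closedBall_zero_iff]
    by_contra! h
    exact hξ (coneKernel_eq_zero_of_le_norm hr h.le _)

variable [MeasurableSpace E] [BorelSpace E]

/-- Fubini's theorem along the family of hyperplanes orthogonal to a unit vector. -/
theorem integral_eq_integral_integral_orthogonal {F : Type*} [NormedAddCommGroup F]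
    [NormedSpace ℝ F] {ω : E} (hω : ‖ω‖ = 1) {G : E → F} (hG : Integrable G) :
    ∫ x, G x = ∫ p : ℝ, ∫ v : (ℝ ∙ ω)ᗮ, G (p • ω + (v : E)) := by
  have h₁ : MeasurePreserving (fun q : ℝ × (ℝ ∙ ω)ᗮ ↦ q.1 • ω + (q.2 : E)) := by
    have h₂ := (LinearIsometryEquiv.toSpanUnitSingleton (𝕜 := ℝ) ω hω).measurePreserving.prod
      (MeasurePreserving.id (volume : Measure (ℝ ∙ ω)ᗮ))
    have h₃ := ((ℝ ∙ ω).orthogonalDecomposition.symm.measurePreserving.comp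
      (WithLp.volume_preserving_toLp (ℝ ∙ ω) (ℝ ∙ ω)ᗮ)).comp h₂
    convert! h₃ using 1
  have hemb : MeasurableEmbedding (fun q : ℝ × (ℝ ∙ ω)ᗮ ↦ q.1 • ω + (q.2 : E)) := by
    convert! MeasurableEquiv.measurableEmbedding
      (((LinearIsometryEquiv.toSpanUnitSingleton (𝕜 := ℝ) ω
        hω).toMeasurableEquiv.prodCongr (MeasurableEquiv.refl (ℝ ∙ ω)ᗮ)).trans
      ((MeasurableEquiv.toLp 2 ((ℝ ∙ ω) × (ℝ ∙ ω)ᗮ)).trans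
        (ℝ ∙ ω).orthogonalDecomposition.symm.toMeasurableEquiv)) using 1
  rw [← h₁.integral_comp hemb G]
  exact integral_prod _ ((h₁.integrable_comp_emb hemb).2 hG)

/-- Continuous functions that are integrable against all polynomial weights. -/
structure RapidlyDecreasing (g : E → ℂ) : Prop where
  continuous : Continuous g
  integrable (k : ℕ) : Integrable fun x ↦ (1 + ‖x‖) ^ k * ‖g x‖

theorem RapidlyDecreasing.integrable_smul {g : E → ℂ} (hg : RapidlyDecreasing g) {w : E → ℝ}
    (hw : Continuous w) {C : ℝ} {k : ℕ} (hwb : ∀ x, |w x| ≤ C * (1 + ‖x‖) ^ k) :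
    Integrable fun x ↦ w x • g x := by
  refine ((hg.integrable k).const_mul C).mono' (hw.smul hg.continuous).aestronglyMeasurable
    (ae_of_all _ fun x ↦ ?_)
  rw [norm_smul, Real.norm_eq_abs, ← mul_assoc]
  gcongr
  exact hwb x

theorem RapidlyDecreasing.smul {g : E → ℂ} (hg : RapidlyDecreasing g) {w : E → ℝ}
    (hw : Continuous w) {C : ℝ} {k : ℕ} (hwb : ∀ x, |w x| ≤ C * (1 + ‖x‖) ^ k) :
    RapidlyDecreasing fun x ↦ w x • g x := by
  refine ⟨hw.smul hg.continuous, fun l ↦ ?_⟩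
  refine ((hg.integrable (l + k)).const_mul C).mono' (((by fun_prop : Continuous fun x : E ↦
    (1 + ‖x‖) ^ l).mul (hw.smul hg.continuous).norm).aestronglyMeasurable) (ae_of_all _ fun x ↦ ?_)
  rw [norm_mul, norm_norm, norm_smul, Real.norm_eq_abs (w x), Real.norm_of_nonneg (by positivity)]
  calc (1 + ‖x‖) ^ l * (|w x| * ‖g x‖) ≤ (1 + ‖x‖) ^ l * (C * (1 + ‖x‖) ^ k * ‖g x‖) := by
        gcongr
        exact hwb x
    _ = C * ((1 + ‖x‖) ^ (l + k) * ‖g x‖) := by ring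

theorem RapidlyDecreasing.add {g h : E → ℂ} (hg : RapidlyDecreasing g)
    (hh : RapidlyDecreasing h) : RapidlyDecreasing fun x ↦ g x + h x := by
  refine ⟨hg.continuous.add hh.continuous, fun l ↦ ?_⟩
  refine ((hg.integrable l).add (hh.integrable l)).mono' (((by fun_prop : Continuous fun x : E ↦
    (1 + ‖x‖) ^ l).mul (hg.continuous.add hh.continuous).norm).aestronglyMeasurable)
    (ae_of_all _ fun x ↦ ?_)
  rw [Real.norm_of_nonneg (by positivity), Pi.add_apply, ← mul_add]
  gcongr
  exact norm_add_le _ _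

theorem SchwartzMap.rapidlyDecreasing (f : SchwartzMap E ℂ) : RapidlyDecreasing f := by
  refine ⟨f.continuous, fun k ↦ ?_⟩
  have h : Integrable fun x : E ↦ ∑ i ∈ Finset.range (k + 1), (k.choose i : ℝ) * (‖x‖ ^ i * ‖f x‖) :=
    integrable_finsetSum _ fun i _ ↦ (f.integrable_pow_mul volume i).const_mul _
  refine h.congr (ae_of_all _ fun x ↦ ?_)
  simp only
  rw [add_comm 1, add_pow, Finset.sum_mul]
  exact Finset.sum_congr rfl fun i _ ↦ by ring

/-- The integrals of `g` against all continuous ridge functions of polynomial growth which vanish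
on a neighbourhood of the closed ball of radius `R₀` are zero. -/
def AnnihilatesRidge (R₀ : ℝ) (g : E → ℂ) : Prop :=
  ∀ ξ : E, ξ ≠ 0 → ∀ r, R₀ < r → ∀ φ : ℝ → ℝ, Continuous φ → ∀ (C : ℝ) (k : ℕ),
    (∀ p, |φ p| ≤ C * (1 + |p|) ^ k) → (∀ p, |p| ≤ r * ‖ξ‖ → φ p = 0) →
    ∫ x, φ (inner ℝ ξ x) • g x = 0

theorem annihilatesRidge_of_integral_hyperplane_eq_zero {R₀ : ℝ} {g : E → ℂ}
    (hg : RapidlyDecreasing g)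
    (h : ∀ (ω : E) (p : ℝ), ‖ω‖ = 1 → R₀ < |p| → ∫ v : (ℝ ∙ ω)ᗮ, g (p • ω + (v : E)) = 0) :
    AnnihilatesRidge R₀ g := by
  intro ξ hξ r hr φ hφ C k hC hzero
  have hξ' : 0 < ‖ξ‖ := norm_pos_iff.2 hξ
  set ω : E := ‖ξ‖⁻¹ • ξ with hωdef
  have hω : ‖ω‖ = 1 := by simp [hωdef, norm_smul, hξ'.ne']
  have hξω : ξ = ‖ξ‖ • ω := by simp [hωdef, smul_smul, hξ'.ne']
  have hinteg : Integrable fun x ↦ φ (inner ℝ ξ x) • g x :=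
    hg.integrable_smul (by fun_prop) (abs_inner_le_growth hC le_rfl)
  rw [integral_eq_integral_integral_orthogonal hω hinteg]
  refine integral_eq_zero_of_ae (ae_of_all _ fun p ↦ ?_)
  have hinner (v : (ℝ ∙ ω)ᗮ) : inner ℝ ξ (p • ω + (v : E)) = ‖ξ‖ * p := by
    have : inner ℝ ω (v : E) = 0 := Submodule.mem_orthogonal_singleton_iff_inner_right.1 v.2
    rw [hξω, inner_smul_left, inner_add_right, inner_smul_right, this,
      real_inner_self_eq_norm_sq, hω]
    simp [norm_smul, hω]
  simp only [hinner, integral_smul, Pi.zero_apply]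
  by_cases hp : |p| ≤ r
  · rw [hzero, zero_smul]
    rw [abs_mul, abs_norm, mul_comm]
    gcongr
  · rw [h ω p hω (hr.trans (not_le.1 hp)), smul_zero]

theorem AnnihilatesRidge.inner_smul {R₀ : ℝ} {g : E → ℂ} (hg : RapidlyDecreasing g)
    (h : AnnihilatesRidge R₀ g) (u : E) : AnnihilatesRidge R₀ fun x ↦ inner ℝ u x • g x := by
  intro ξ hξ r hr φ hφ C k hC hzero
  have hξ' : 0 < ‖ξ‖ := norm_pos_iff.2 hξ
  have hC0 : 0 ≤ C := by simpa using (abs_nonneg _).trans (hC 0)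
  set H : ℝ → ℝ := fun p ↦ ∫ t in (0 : ℝ)..p, φ t with hH
  have hHd (p : ℝ) : HasDerivAt H (φ p) p := (hφ.integral_hasStrictDerivAt 0 p).hasDerivAt
  have hHc : Continuous H := continuous_iff_continuousAt.2 fun p ↦ (hHd p).continuousAt
  have hHb (p : ℝ) : |H p| ≤ C * (1 + |p|) ^ (k + 1) := by
    have h₁ : ‖∫ t in (0 : ℝ)..p, φ t‖ ≤ C * (1 + |p|) ^ k * |p - 0| := by
      refine intervalIntegral.norm_integral_le_of_norm_le_const fun t ht ↦ (hC t).trans ?_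
      have : |t| ≤ |p| := by
        rcases Set.mem_uIoc.1 ht with ⟨h₁, h₂⟩ | ⟨h₁, h₂⟩
        · rw [abs_of_pos h₁]
          exact h₂.trans (le_abs_self p)
        · rw [abs_of_nonpos h₂, abs_of_nonpos (h₁.le.trans h₂)]
          linarith
      gcongr
    rw [sub_zero, Real.norm_eq_abs] at h₁
    refine h₁.trans ?_
    rw [pow_succ, ← mul_assoc]
    gcongr
    linarith
  have hHz (p : ℝ) (hp : |p| ≤ r * ‖ξ‖) : H p = 0 := by
    refine intervalIntegral.integral_zero_ae (ae_of_all _ fun t ht ↦ hzero t (le_trans ?_ hp))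
    rcases Set.mem_uIoc.1 ht with ⟨h₁, h₂⟩ | ⟨h₁, h₂⟩
    · rw [abs_of_pos h₁]
      exact h₂.trans (le_abs_self p)
    · rw [abs_of_nonpos h₂, abs_of_nonpos (h₁.le.trans h₂)]
      linarith
  set M : ℝ := ‖ξ‖ + ‖u‖ with hM
  have hMt (t : ℝ) (ht : t ∈ Set.Icc (-1 : ℝ) 1) : ‖ξ + t • u‖ ≤ M := by
    refine (norm_add_le _ _).trans ?_
    rw [norm_smul, Real.norm_eq_abs]
    have := mul_le_of_le_one_left (norm_nonneg u) (abs_le.2 ht)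
    linarith
  have hline (x : E) (t : ℝ) : inner ℝ (ξ + t • u) x = inner ℝ ξ x + t * inner ℝ u x := by
    rw [inner_add_left, real_inner_smul_left]
  have hnhds : Set.Icc (-1 : ℝ) 1 ∈ 𝓝 (0 : ℝ) := Icc_mem_nhds (by norm_num) (by norm_num)
  have key := hasDerivAt_integral_of_dominated_loc_of_deriv_le (μ := (volume : Measure E))
    (F := fun (t : ℝ) x ↦ H (inner ℝ (ξ + t • u) x) • g x)
    (F' := fun (t : ℝ) x ↦ (φ (inner ℝ (ξ + t • u) x) * inner ℝ u x) • g x)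
    (bound := fun x ↦ C * (1 + M) ^ k * ‖u‖ * ((1 + ‖x‖) ^ (k + 1) * ‖g x‖)) hnhds
    (Eventually.of_forall fun t ↦ ((hHc.comp (by fun_prop)).smul
      hg.continuous).aestronglyMeasurable)
    (hg.integrable_smul (w := fun x ↦ H (inner ℝ (ξ + (0 : ℝ) • u) x)) (by fun_prop)
      (abs_inner_le_growth hHb le_rfl))
    (((hφ.comp (by fun_prop : Continuous fun x ↦ inner ℝ (ξ + (0 : ℝ) • u) x)).mul
      (by fun_prop : Continuous fun x ↦ inner ℝ u x)).smul hg.continuous).aestronglyMeasurable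
    (ae_of_all _ fun x t ht ↦ ?_) ((hg.integrable (k + 1)).const_mul _)
    (ae_of_all _ fun x t ht ↦ ?_)
  · have hev : (fun t : ℝ ↦ ∫ x, H (inner ℝ (ξ + t • u) x) • g x) =ᶠ[𝓝 0] fun _ ↦ 0 := by
      have hc : Continuous fun t : ℝ ↦ ‖ξ + t • u‖ := by fun_prop
      have h₁ : ∀ᶠ t in 𝓝 (0 : ℝ), 0 < ‖ξ + t • u‖ :=
        hc.continuousAt.eventually (lt_mem_nhds (by simpa using hξ))
      have h₂ : ∀ᶠ t in 𝓝 (0 : ℝ), (R₀ + r) / 2 * ‖ξ + t • u‖ < r * ‖ξ‖ := by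
        have h₃ : (R₀ + r) / 2 * ‖ξ + (0 : ℝ) • u‖ < r * ‖ξ‖ := by
          rw [zero_smul, add_zero]
          gcongr
          linarith
        exact (continuous_const.mul hc).continuousAt.eventually (gt_mem_nhds h₃)
      filter_upwards [h₁, h₂] with t h₁ h₂
      exact h _ (norm_pos_iff.1 h₁) ((R₀ + r) / 2) (by linarith) H hHc C (k + 1) hHb
        fun p hp ↦ hHz p (hp.trans h₂.le)
    have hd := key.2.unique ((hasDerivAt_const (0 : ℝ) (0 : ℂ)).congr_of_eventuallyEq hev)
    simpa [mul_assoc] using hd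
  · have h₁ := abs_inner_le_growth hC (hMt t ht) x
    have h₂ := abs_real_inner_le_norm u x
    rw [norm_smul, Real.norm_eq_abs, abs_mul, ← mul_assoc]
    refine mul_le_mul_of_nonneg_right ?_ (norm_nonneg _)
    calc _ ≤ (C * (1 + M) ^ k * (1 + ‖x‖) ^ k) * (‖u‖ * ‖x‖) := by gcongr
      _ ≤ (C * (1 + M) ^ k * (1 + ‖x‖) ^ k) * (‖u‖ * (1 + ‖x‖)) := by
        gcongr
        linarith
      _ = _ := by ring
  · refine HasDerivAt.smul_const (c := fun t ↦ H (inner ℝ (ξ + t • u) x)) ?_ _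
    have hl : HasDerivAt (fun t : ℝ ↦ inner ℝ (ξ + t • u) x) (inner ℝ u x) t := by
      simp only [hline]
      simpa using ((hasDerivAt_id t).mul_const (inner ℝ u x)).const_add (inner ℝ ξ x)
    exact (hHd _).comp t hl

/-- The superposition of the ridge functions `coneKernel r ξ ⟪ξ, ·⟫`. -/
def coneAverage (r : ℝ) (x : E) : ℝ := ∫ ξ : E, coneKernel r ξ (inner ℝ ξ x)

theorem AnnihilatesRidge.integral_coneAverage_smul {R₀ r : ℝ} (hR₀ : 0 < R₀) (hr : R₀ < r)
    {g : E → ℂ} (hg : RapidlyDecreasing g) (h : AnnihilatesRidge R₀ g) :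
    ∫ x, coneAverage r x • g x = 0 := by
  have hr0 : 0 < r := hR₀.trans hr
  have hcont : Continuous fun q : E × E ↦ coneKernel r q.2 (inner ℝ q.2 q.1) • g q.1 :=
    ((continuous_coneKernel r).comp (continuous_snd.prodMk (by fun_prop))).smul
      (hg.continuous.comp continuous_fst)
  have hinteg : Integrable (fun q : E × E ↦ coneKernel r q.2 (inner ℝ q.2 q.1) • g q.1)
      (volume.prod volume) := by
    have h₁ : Integrable ((Metric.closedBall (0 : E) r⁻¹).indicator fun _ ↦ (1 : ℝ)) :=
      (integrable_indicator_iff measurableSet_closedBall).2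
        (integrableOn_const (measure_closedBall_lt_top.ne))
    have h₂ : Integrable g := by
      simpa using hg.integrable_smul (w := fun _ ↦ 1) (C := 1) (k := 0) continuous_const (by simp)
    refine (h₂.norm.mul_prod h₁).mono' hcont.aestronglyMeasurable (ae_of_all _ fun q ↦ ?_)
    rw [norm_smul, Real.norm_of_nonneg (coneKernel_nonneg _ _ _), mul_comm]
    refine mul_le_mul_of_nonneg_left ?_ (norm_nonneg _)
    by_cases hq : q.2 ∈ Metric.closedBall (0 : E) r⁻¹
    · rw [Set.indicator_of_mem hq]
      exact coneKernel_le_one _ _ _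
    · rw [Set.indicator_of_notMem hq, coneKernel_eq_zero_of_le_norm hr0]
      rw [mem_closedBall_zero_iff, not_le] at hq
      exact hq.le
  simp only [coneAverage, ← integral_smul_const]
  rw [integral_integral_swap hinteg]
  refine integral_eq_zero_of_ae (ae_of_all _ fun ξ ↦ ?_)
  by_cases hξ : ξ = 0
  · simp [hξ, coneKernel]
  · exact h ξ hξ r hr (coneKernel r ξ) ((continuous_coneKernel r).comp (.prodMk_right ξ)) 1 0
      (fun p ↦ by simpa [abs_of_nonneg (coneKernel_nonneg r ξ p)] using coneKernel_le_one r ξ p)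
      fun p hp ↦ coneKernel_eq_zero hp

theorem coneAverage_eq_zero {r : ℝ} {x : E} (h : ‖x‖ ≤ r) : coneAverage r x = 0 := by
  refine integral_eq_zero_of_ae (ae_of_all _ fun ξ ↦ ?_)
  refine coneKernel_eq_zero ((abs_real_inner_le_norm ξ x).trans ?_)
  rw [mul_comm]
  gcongr

theorem coneAverage_eq_of_norm_eq (r : ℝ) {x y : E} (h : ‖x‖ = ‖y‖) :
    coneAverage r x = coneAverage r y := by
  set T := (ℝ ∙ (x - y))ᗮ.reflection
  have hT : T x = y := Submodule.reflection_sub h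
  have := T.measurePreserving.integral_comp T.toHomeomorph.measurableEmbedding
    fun ξ ↦ coneKernel r ξ (inner ℝ ξ y)
  rw [coneAverage, coneAverage, ← this]
  refine integral_congr_ae (ae_of_all _ fun ξ ↦ ?_)
  simp only [← hT, LinearIsometryEquiv.inner_map_map, coneKernel, LinearIsometryEquiv.norm_map]

theorem coneAverage_pos {x : E} (hx : ‖x‖ = 2) : 0 < coneAverage 1 x := by
  refine (continuous_coneKernel_inner 1 x).integral_pos_of_hasCompactSupport_nonneg_nonzero
    (hasCompactSupport_coneKernel one_pos x) (fun ξ ↦ coneKernel_nonneg _ _ _)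
    (x := (1 / 8 : ℝ) • x) ?_
  have h₁ : inner ℝ ((1 / 8 : ℝ) • x) x = 1 / 2 := by
    rw [real_inner_smul_left, real_inner_self_eq_norm_sq, hx]
    norm_num
  have h₂ : ‖(1 / 8 : ℝ) • x‖ = 1 / 4 := by
    rw [norm_smul, hx]
    norm_num
  rw [coneKernel, h₁, h₂]
  refine mul_ne_zero (pow_ne_zero _ (Real.sqrt_ne_zero'.2 (by norm_num))) ?_
  rw [abs_of_pos (by norm_num), max_eq_right (by norm_num)]
  norm_num

theorem coneAverage_smul {e : E} (he : ‖e‖ = 1) {r s : ℝ} (hr : 0 < r) (hs : r < s) :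
    coneAverage r (s • e) = s⁻¹ * r ^ (Module.finrank ℝ E + 1) *
      ((s ^ 2 - r ^ 2) / (r * s) ^ 2) ^ Module.finrank ℝ E *
      ∫ τ : ℝ, ∫ v : (ℝ ∙ e)ᗮ, √(τ ^ 2 - ‖v‖ ^ 2) ^ (Module.finrank ℝ E + 1) *
        max 0 (1 - |τ|) := by
  have hs0 : 0 < s := hr.trans hs
  set d := Module.finrank ℝ E with hd
  have hfin : Module.finrank ℝ (ℝ ∙ e)ᗮ + 1 = d := by
    have h₁ := (ℝ ∙ e).finrank_add_finrank_orthogonal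
    rw [finrank_span_singleton (by rintro rfl; simp at he)] at h₁
    lia
  have hsr : 0 < s ^ 2 - r ^ 2 := by nlinarith
  set b : ℝ := (s ^ 2 - r ^ 2) / (r * s) ^ 2 with hb
  have hb0 : 0 < b := by positivity
  set a : ℝ := √b with ha
  have ha0 : 0 < a := Real.sqrt_pos.2 hb0
  have hab : a ^ 2 = b := Real.sq_sqrt hb0.le
  have hker (t : ℝ) (v : (ℝ ∙ e)ᗮ) :
      coneKernel r (t • e + (v : E)) (inner ℝ (t • e + (v : E)) (s • e)) =
        (r * a) ^ (d + 1) *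
          (√((s * t) ^ 2 - ‖a⁻¹ • v‖ ^ 2) ^ (d + 1) * max 0 (1 - |s * t|)) := by
    have h₀ : inner ℝ (v : E) e = 0 := Submodule.mem_orthogonal_singleton_iff_inner_left.1 v.2
    have h₁ : inner ℝ (t • e + (v : E)) (s • e) = s * t := by
      rw [inner_smul_right, inner_add_left, real_inner_smul_left, h₀,
        real_inner_self_eq_norm_sq, he]
      ring
    have h₂ : ‖t • e + (v : E)‖ ^ 2 = t ^ 2 + ‖v‖ ^ 2 := by
      rw [norm_add_sq_real, real_inner_smul_left, real_inner_comm, h₀, norm_smul, he]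
      simp
    have h₃ : (s * t) ^ 2 - r ^ 2 * (t ^ 2 + ‖v‖ ^ 2) =
        (r * a) ^ 2 * ((s * t) ^ 2 - ‖a⁻¹ • v‖ ^ 2) := by
      rw [norm_smul, norm_inv, Real.norm_of_nonneg ha0.le, mul_pow r a, mul_pow a⁻¹, inv_pow, hab,
        hb]
      field_simp
      ring
    rw [h₁, coneKernel, h₂, h₃, Real.sqrt_mul (by positivity), Real.sqrt_sq (by positivity),
      mul_pow, ← hd, mul_assoc]
  have hpow : (r * a) ^ (d + 1) * |((a⁻¹ : ℝ) ^ Module.finrank ℝ (ℝ ∙ e)ᗮ)⁻¹| =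
      r ^ (d + 1) * b ^ d := by
    rw [abs_of_pos (by positivity), inv_pow, inv_inv, mul_pow, mul_assoc, ← pow_add, ← hab,
      ← pow_mul]
    congr 2
    lia
  rw [coneAverage, integral_eq_integral_integral_orthogonal he
    ((continuous_coneKernel_inner r _).integrable_of_hasCompactSupport
      (hasCompactSupport_coneKernel hr _))]
  simp only [hker, integral_const_mul]
  have hscale (t : ℝ) := Measure.integral_comp_smul (volume : Measure (ℝ ∙ e)ᗮ)
    (fun v ↦ √((s * t) ^ 2 - ‖v‖ ^ 2) ^ (d + 1) * max 0 (1 - |s * t|)) a⁻¹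
  simp only [hscale, smul_eq_mul, integral_const_mul]
  rw [Measure.integral_comp_mul_left (fun τ : ℝ ↦ ∫ v : (ℝ ∙ e)ᗮ,
    √(τ ^ 2 - ‖v‖ ^ 2) ^ (d + 1) * max 0 (1 - |τ|)) s, ← mul_assoc, hpow,
    abs_of_pos (by positivity), smul_eq_mul]
  ring

/-- The cone average is a positive multiple of an explicit truncated power of the norm. -/
theorem exists_coneAverage_eq [Nontrivial E] : ∃ c : ℝ, 0 < c ∧ ∀ r : ℝ, 0 < r → ∀ x : E,
    coneAverage r x = c * (r ^ (Module.finrank ℝ E + 1) / r ^ (2 * Module.finrank ℝ E)) *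
      (max (‖x‖ ^ 2 - r ^ 2) 0 ^ Module.finrank ℝ E *
        (‖x‖ ^ (2 * Module.finrank ℝ E + 1))⁻¹) := by
  obtain ⟨e, he⟩ := exists_norm_eq E zero_le_one
  set d := Module.finrank ℝ E with hd
  refine ⟨∫ τ : ℝ, ∫ v : (ℝ ∙ e)ᗮ, √(τ ^ 2 - ‖v‖ ^ 2) ^ (d + 1) * max 0 (1 - |τ|), ?_,
    fun r hr x ↦ ?_⟩
  · have h₁ := coneAverage_pos (x := (2 : ℝ) • e) (by simp [norm_smul, he])
    rw [coneAverage_smul he one_pos one_lt_two] at h₁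
    refine pos_of_mul_pos_right h₁ ?_
    norm_num
  · rcases le_or_gt ‖x‖ r with hx | hx
    · have : max (‖x‖ ^ 2 - r ^ 2) 0 = 0 :=
        max_eq_right (by nlinarith [norm_nonneg x])
      rw [coneAverage_eq_zero hx, this, zero_pow Module.finrank_pos.ne']
      simp
    · have hx0 : 0 < ‖x‖ := hr.trans hx
      have hsr : 0 < ‖x‖ ^ 2 - r ^ 2 := by nlinarith
      rw [coneAverage_eq_of_norm_eq r (y := ‖x‖ • e) (by simp [norm_smul, he]),
        coneAverage_smul he hr hx, max_eq_left hsr.le, div_pow, ← hd, ← pow_mul, mul_pow, pow_succ ‖x‖]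
      field_simp
      ring

theorem AnnihilatesRidge.integral_truncatedPow_smul [Nontrivial E] {R₀ r : ℝ} (hR₀ : 0 < R₀)
    (hr : R₀ < r) {g : E → ℂ} (hg : RapidlyDecreasing g) (h : AnnihilatesRidge R₀ g) :
    ∫ x : E, (max (‖x‖ ^ 2 - r ^ 2) 0 ^ Module.finrank ℝ E *
        (max ‖x‖ R₀ ^ (2 * Module.finrank ℝ E + 1))⁻¹) • g x = 0 := by
  obtain ⟨c, hc, hcr⟩ := exists_coneAverage_eq (E := E)
  have hr0 : 0 < r := hR₀.trans hr
  have h₁ := h.integral_coneAverage_smul hR₀ hr hg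
  simp only [hcr r hr0, mul_smul _ _ (g _), integral_smul] at h₁
  rw [smul_eq_zero_iff_right (by positivity)] at h₁
  rw [← h₁]
  refine integral_congr_ae (ae_of_all _ fun x ↦ ?_)
  simp only [← mul_smul]
  congr 1
  rcases le_or_gt ‖x‖ r with hx | hx
  · rw [max_eq_right (by nlinarith [norm_nonneg x]), zero_pow Module.finrank_pos.ne', zero_mul,
      zero_mul]
  · rw [max_eq_left (hr.trans hx).le]

/-- Alternating sums of truncated powers whose nodes are equally spaced vanish beyond the last
node. -/
theorem sum_truncatedPow_eq_zero {d : ℕ} {a δ u : ℝ} (hδ : 0 < δ)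
    (hu : a + (d + 1 : ℕ) * δ ≤ u) :
    ∑ k ∈ Finset.range (d + 2), ((-1 : ℝ) ^ (d + 1 - k) * (d + 1).choose k) *
      max (u - (a + k * δ)) 0 ^ d = 0 := by
  have h₁ := congrFun (fwdDiff_iter_pow_eq_zero_of_lt (R := ℝ) (Nat.lt_succ_self d)) ((a - u) / δ)
  rw [fwdDiff_iter_eq_sum_shift] at h₁
  have h₂ : ∀ k ∈ Finset.range (d + 2), ((-1 : ℝ) ^ (d + 1 - k) * (d + 1).choose k) *
      max (u - (a + k * δ)) 0 ^ d = (-δ) ^ d * (((-1 : ℤ) ^ (d + 1 - k) * (d + 1).choose k) •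
        ((a - u) / δ + k • (1 : ℝ)) ^ d) := by
    intro k hk
    have hk' : (k : ℝ) ≤ (d + 1 : ℕ) := by
      exact_mod_cast Nat.lt_succ_iff.1 (Finset.mem_range.1 hk)
    have hm : 0 ≤ u - (a + k * δ) := by nlinarith
    have he : u - (a + k * δ) = -δ * ((a - u) / δ + k • (1 : ℝ)) := by
      field_simp
      simp only [nsmul_eq_mul]
      ring
    rw [max_eq_left hm, he, mul_pow, zsmul_eq_mul]
    push_cast
    ring
  rw [Finset.sum_congr rfl h₂, ← Finset.mul_sum, h₁]
  simp

theorem sum_truncatedPow_of_le {d : ℕ} (hd : d ≠ 0) {a δ u : ℝ} (hδ : 0 < δ) (hu : u ≤ a + δ) :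
    ∑ k ∈ Finset.range (d + 2), ((-1 : ℝ) ^ (d + 1 - k) * (d + 1).choose k) *
      max (u - (a + k * δ)) 0 ^ d = (-1) ^ (d + 1) * max (u - a) 0 ^ d := by
  rw [Finset.sum_range_succ', Finset.sum_eq_zero]
  · simp
  · intro k _
    rw [max_eq_right, zero_pow hd, mul_zero]
    push_cast
    nlinarith [mul_nonneg (Nat.cast_nonneg (α := ℝ) k) hδ.le]

theorem AnnihilatesRidge.mvPolynomial_smul {n : ℕ} {R₀ : ℝ}
    (P : MvPolynomial (Fin n) ℝ) {g : EuclideanSpace ℝ (Fin n) → ℂ}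
    (hg : RapidlyDecreasing g) (h : AnnihilatesRidge R₀ g) :
    RapidlyDecreasing (fun x ↦ MvPolynomial.eval x.ofLp P • g x) ∧
      AnnihilatesRidge R₀ fun x ↦ MvPolynomial.eval x.ofLp P • g x := by
  induction P using MvPolynomial.induction_on generalizing g with
  | C a =>
    simp only [MvPolynomial.eval_C]
    refine ⟨hg.smul (C := |a|) (k := 0) continuous_const (by simp), ?_⟩
    intro ξ hξ r hr φ hφ C k hC hz
    simp only [smul_comm _ a]
    rw [integral_smul, h ξ hξ r hr φ hφ C k hC hz, smul_zero]
  | add p q hp hq =>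
    simp only [map_add, add_smul]
    obtain ⟨hp₁, hp₂⟩ := hp hg h
    obtain ⟨hq₁, hq₂⟩ := hq hg h
    refine ⟨hp₁.add hq₁, ?_⟩
    intro ξ hξ r hr φ hφ C k hC hz
    simp only [smul_add]
    rw [integral_add, hp₂ ξ hξ r hr φ hφ C k hC hz, hq₂ ξ hξ r hr φ hφ C k hC hz, add_zero]
    · exact hp₁.integrable_smul (w := fun x ↦ φ (inner ℝ ξ x)) (by fun_prop)
        (abs_inner_le_growth hC le_rfl)
    · exact hq₁.integrable_smul (w := fun x ↦ φ (inner ℝ ξ x)) (by fun_prop)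
        (abs_inner_le_growth hC le_rfl)
  | mul_X p i hp =>
    have hi (x : EuclideanSpace ℝ (Fin n)) :
        inner ℝ (EuclideanSpace.single i (1 : ℝ)) x = x i := by
      simp [EuclideanSpace.inner_single_left]
    have h₁ := h.inner_smul hg (EuclideanSpace.single i 1)
    have h₂ : RapidlyDecreasing fun x : EuclideanSpace ℝ (Fin n) ↦ x i • g x := by
      refine hg.smul (w := fun x ↦ x i) (C := 1) (k := 1) (by fun_prop) fun x ↦ ?_
      have := PiLp.norm_apply_le x i
      rw [Real.norm_eq_abs] at this
      linarith
    simp only [hi] at h₁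
    simpa only [map_mul, MvPolynomial.eval_X, mul_smul] using hp h₂ h₁

/-- A continuous compactly supported function all of whose moments vanish is zero. -/
theorem eq_zero_of_forall_integral_mvPolynomial_mul_eq_zero {n : ℕ}
    {g : EuclideanSpace ℝ (Fin n) → ℝ} (hg : Continuous g) (hgc : HasCompactSupport g)
    (h : ∀ P : MvPolynomial (Fin n) ℝ, ∫ x, MvPolynomial.eval x.ofLp P * g x = 0) : g = 0 := by
  set coord : Fin n → C(EuclideanSpace ℝ (Fin n), ℝ) := fun i ↦ ⟨fun x ↦ x i, by fun_prop⟩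
  have hcoord (P : MvPolynomial (Fin n) ℝ) (x : EuclideanSpace ℝ (Fin n)) :
      MvPolynomial.aeval coord P x = MvPolynomial.eval x.ofLp P := by
    induction P using MvPolynomial.induction_on with
    | C a => simp
    | add p q hp hq => simp [hp, hq]
    | mul_X p i hp => simp [hp, coord]
  have hsep : (MvPolynomial.aeval (R := ℝ) coord).range.SeparatesPoints := by
    intro x y hxy
    obtain ⟨i, hi⟩ : ∃ i, x i ≠ y i := by
      by_contra! hxy'
      exact hxy (PiLp.ext hxy')
    exact ⟨_, ⟨coord i, ⟨MvPolynomial.X i, by simp⟩, rfl⟩, hi⟩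
  have hinteg : Integrable g := hg.integrable_of_hasCompactSupport hgc
  have hle (ε : ℝ) (hε : 0 < ε) : ∫ x, g x * g x ≤ ε * ∫ x, |g x| := by
    obtain ⟨q, ⟨P, rfl⟩, hP⟩ :=
      ContinuousMap.exists_mem_subalgebra_near_continuous_of_isCompact_of_separatesPoints hsep
        ⟨g, hg⟩ hgc hε
    have hPc : Continuous fun x : EuclideanSpace ℝ (Fin n) ↦ MvPolynomial.eval x.ofLp P :=
      P.continuous_eval.comp (PiLp.continuous_ofLp 2 _)
    have hi₁ : Integrable fun x ↦ g x * g x :=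
      (hg.mul hg).integrable_of_hasCompactSupport hgc.mul_left
    have hi₂ : Integrable fun x ↦ MvPolynomial.eval x.ofLp P * g x :=
      (hPc.mul hg).integrable_of_hasCompactSupport hgc.mul_left
    have h₁ := integral_sub hi₁ hi₂
    rw [h P, sub_zero] at h₁
    rw [← h₁, ← integral_const_mul]
    refine integral_mono (hi₁.sub hi₂) (hinteg.abs.const_mul ε) fun x ↦ ?_
    by_cases hx : x ∈ tsupport g
    · have h₂ : ‖MvPolynomial.aeval coord P x - g x‖ < ε := hP x hx
      rw [hcoord, norm_sub_rev, Real.norm_eq_abs] at h₂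
      simp only [← sub_mul]
      refine (le_abs_self _).trans ?_
      rw [abs_mul]
      gcongr
    · simp [image_eq_zero_of_notMem_tsupport hx]
  have hzero : ∫ x, g x * g x ≤ 0 := by
    have hlim : Tendsto (fun ε : ℝ ↦ ε * ∫ x, |g x|) (𝓝[>] 0) (𝓝 0) := by
      have : Tendsto (fun ε : ℝ ↦ ε * ∫ x, |g x|) (𝓝 0) (𝓝 (0 * ∫ x, |g x|)) :=
        tendsto_id.mul_const _
      rw [zero_mul] at this
      exact this.mono_left nhdsWithin_le_nhds
    exact ge_of_tendsto hlim (eventually_mem_nhdsWithin.mono hle)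
  by_contra hne
  obtain ⟨x, hx⟩ := Function.ne_iff.1 hne
  exact hzero.not_gt ((hg.mul hg).integral_pos_of_hasCompactSupport_nonneg_nonzero hgc.mul_left
    (fun x ↦ mul_self_nonneg (g x)) (mul_self_ne_zero.2 hx))

theorem eq_zero_of_forall_integral_mvPolynomial_smul_eq_zero {n : ℕ}
    {g : EuclideanSpace ℝ (Fin n) → ℂ} (hg : Continuous g) (hgc : HasCompactSupport g)
    (h : ∀ P : MvPolynomial (Fin n) ℝ, ∫ x, MvPolynomial.eval x.ofLp P • g x = 0) : g = 0 := by
  have hinteg (P : MvPolynomial (Fin n) ℝ) : Integrable fun x ↦ MvPolynomial.eval x.ofLp P • g x :=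
    (Continuous.smul (P.continuous_eval.comp (PiLp.continuous_ofLp 2 _))
      hg).integrable_of_hasCompactSupport hgc.smul_left
  have hre : (fun x ↦ (g x).re) = 0 := by
    refine eq_zero_of_forall_integral_mvPolynomial_mul_eq_zero (Complex.continuous_re.comp hg)
      (hgc.comp_left Complex.zero_re) fun P ↦ ?_
    have := Complex.reCLM.integral_comp_comm (hinteg P)
    rw [h P] at this
    simpa using this
  have him : (fun x ↦ (g x).im) = 0 := by
    refine eq_zero_of_forall_integral_mvPolynomial_mul_eq_zero (Complex.continuous_im.comp hg)
      (hgc.comp_left Complex.zero_im) fun P ↦ ?_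
    have := Complex.imCLM.integral_comp_comm (hinteg P)
    rw [h P] at this
    simpa using this
  exact funext fun x ↦ Complex.ext (congrFun hre x) (congrFun him x)

theorem AnnihilatesRidge.eq_zero {n : ℕ} {R₀ : ℝ} (hR₀ : 0 < R₀)
    {g : EuclideanSpace ℝ (Fin n) → ℂ} (hg : RapidlyDecreasing g) (h : AnnihilatesRidge R₀ g)
    {x₀ : EuclideanSpace ℝ (Fin n)} (hx₀ : R₀ < ‖x₀‖) : g x₀ = 0 := by
  have : Nontrivial (EuclideanSpace ℝ (Fin n)) :=
    ⟨x₀, 0, norm_pos_iff.1 (hR₀.trans hx₀)⟩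
  set d := Module.finrank ℝ (EuclideanSpace ℝ (Fin n)) with hd
  have hd0 : d ≠ 0 := Module.finrank_pos.ne'
  obtain ⟨a, ha₁, ha₂⟩ : ∃ a, R₀ ^ 2 < a ∧ a < ‖x₀‖ ^ 2 :=
    exists_between (by gcongr)
  set δ := ‖x₀‖ ^ 2 - a with hδdef
  have hδ : 0 < δ := sub_pos.2 ha₂
  have ha0 : 0 < a := (sq_nonneg R₀).trans_lt ha₁
  set c : ℕ → ℝ := fun k ↦ (-1 : ℝ) ^ (d + 1 - k) * (d + 1).choose k with hc
  set w : EuclideanSpace ℝ (Fin n) → ℝ := fun x ↦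
    (∑ k ∈ Finset.range (d + 2), c k * max (‖x‖ ^ 2 - (a + k * δ)) 0 ^ d) *
      (max ‖x‖ R₀ ^ (2 * d + 1))⁻¹ with hw
  have hmax (x : EuclideanSpace ℝ (Fin n)) : 0 < max ‖x‖ R₀ := lt_max_of_lt_right hR₀
  have hinv : Continuous fun x : EuclideanSpace ℝ (Fin n) ↦ (max ‖x‖ R₀ ^ (2 * d + 1))⁻¹ :=
    Continuous.inv₀ (by fun_prop) fun x ↦ (pow_pos (hmax x) _).ne'
  have hwc : Continuous w := Continuous.mul (by fun_prop) hinv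
  have hws : HasCompactSupport w := by
    refine HasCompactSupport.of_support_subset_isCompact
      (isCompact_closedBall 0 √(a + (d + 1 : ℕ) * δ)) fun x hx ↦ ?_
    rw [mem_closedBall_zero_iff]
    by_contra! hlt
    refine hx ?_
    simp only [hw, hc]
    rw [sum_truncatedPow_eq_zero hδ (Real.lt_sq_of_sqrt_lt hlt).le, zero_mul]
  have hinteg (P : MvPolynomial (Fin n) ℝ) :
      ∫ x, MvPolynomial.eval x.ofLp P • (w x • g x) = 0 := by
    obtain ⟨hP₁, hP₂⟩ := h.mvPolynomial_smul P hg
    have hterm (k : ℕ) : R₀ < √(a + k * δ) ∧ √(a + k * δ) ^ 2 = a + k * δ := by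
      have hk : 0 ≤ k * δ := by positivity
      exact ⟨Real.lt_sqrt_of_sq_lt (by linarith), Real.sq_sqrt (by linarith)⟩
    have hexp (x : EuclideanSpace ℝ (Fin n)) : MvPolynomial.eval x.ofLp P • (w x • g x) =
        ∑ k ∈ Finset.range (d + 2), c k • ((max (‖x‖ ^ 2 - √(a + k * δ) ^ 2) 0 ^ d *
          (max ‖x‖ R₀ ^ (2 * d + 1))⁻¹) • (MvPolynomial.eval x.ofLp P • g x)) := by
      simp only [(hterm _).2, smul_smul, ← Finset.sum_smul]
      congr 1
      simp only [hw, Finset.sum_mul, Finset.mul_sum]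
      exact Finset.sum_congr rfl fun k _ ↦ by ring
    simp only [hexp]
    rw [integral_finsetSum]
    · refine Finset.sum_eq_zero fun k _ ↦ ?_
      rw [integral_smul, hP₂.integral_truncatedPow_smul hR₀ (hterm k).1 hP₁, smul_zero]
    · intro k _
      refine Integrable.smul (c k) (hP₁.integrable_smul (w := fun x ↦
        max (‖x‖ ^ 2 - √(a + k * δ) ^ 2) 0 ^ d * (max ‖x‖ R₀ ^ (2 * d + 1))⁻¹)
        (C := (R₀ ^ (2 * d + 1))⁻¹) (k := 2 * d) (Continuous.mul (by fun_prop) hinv) fun x ↦ ?_)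
      rw [abs_of_nonneg (by have := hmax x; positivity), mul_comm, pow_mul]
      gcongr
      · exact le_max_right _ _
      · exact max_le (by nlinarith [norm_nonneg x, sq_nonneg √(a + k * δ)]) (by positivity)
  have hz := congrFun (eq_zero_of_forall_integral_mvPolynomial_smul_eq_zero
    (hwc.smul hg.continuous) hws.smul_right hinteg) x₀
  refine (smul_eq_zero.1 (show w x₀ • g x₀ = 0 from hz)).resolve_left ?_
  simp only [hw, hc]
  rw [sum_truncatedPow_of_le hd0 hδ (by simp [hδdef]), max_eq_left hδ.le]
  have := hmax x₀
  positivity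

end RadonSupport

/-- support theorem for the classical Radon transform: if
`f ∈ S(ℝⁿ)` and `Rf(ω,p) = 0` whenever `|p| > R₀ > 0`, then `f(x) = 0` for all
`‖x‖ > R₀`. -/
theorem radon_support_theorem {n : ℕ}
    (f : SchwartzMap (EuclideanSpace ℝ (Fin n)) ℂ) (R₀ : ℝ) (hR₀ : 0 < R₀)
    (hvanish : ∀ (ω : EuclideanSpace ℝ (Fin n)) (p : ℝ), ‖ω‖ = 1 → R₀ < |p| →
      radonTransform f ω p = 0) :
    ∀ x : EuclideanSpace ℝ (Fin n), R₀ < ‖x‖ → f x = 0 :=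
  fun _ hx ↦ (annihilatesRidge_of_integral_hyperplane_eq_zero f.rapidlyDecreasing
    hvanish).eq_zero hR₀ f.rapidlyDecreasing hx

end
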